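/- arXiv:1810.13116 — 8 statements merged into one kernel-verified Lean document; each statement's English description precedes it below -/
import Mathlib

section
/- Suppose λ* ≥ 0 and α* ∈ [0,1] satisfy E[(1 − π_{λ*,α*}) r_C] = r_th (the CU's rate constraint holds with equality under the threshold policy). Then the threshold policy π_{λ*,α*} is an optimal cooperation policy: for every feasible policy π, E[π r_D] ≤ E[π_{λ*,α*} r_D]. -/
open MeasureTheory Filter

/-- The threshold cooperation policy `π_{λ,α}`: value `0` when `λ·r_C > r_D`,
`α` when `λ·r_C = r_D`, and `1` when `λ·r_C < r_D`. -/
noncomputable def thresholdPolicy {Ω : Type*} (rC rD : Ω → ℝ) (lam a : ℝ) : Ω → ℝ :=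
  fun ω => if rD ω < lam * rC ω then 0 else if lam * rC ω = rD ω then a else 1

/-- `F(λ) = E[r_C · 1{λ r_C ≥ r_D}]`. -/
noncomputable def Fthr {Ω : Type*} [MeasurableSpace Ω] (P : Measure Ω)
    (rC rD : Ω → ℝ) (lam : ℝ) : ℝ :=
  ∫ ω, (if rD ω ≤ lam * rC ω then rC ω else 0) ∂P

/-- The dual function `g(λ) = E[max(r_D − λ r_C, 0)] + λ (E[r_C] − r_th)`. -/
noncomputable def dualFn {Ω : Type*} [MeasurableSpace Ω] (P : Measure Ω)
    (rC rD : Ω → ℝ) (rth lam : ℝ) : ℝ :=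
  (∫ ω, max (rD ω - lam * rC ω) 0 ∂P) + lam * ((∫ ω, rC ω ∂P) - rth)

/-- if the threshold policy `π_{λ*,α*}` satisfies the CU's rate
constraint with equality, then it is an optimal cooperation policy. -/
theorem threshold_policy_optimal
    {Ω : Type*} [MeasurableSpace Ω] (P : Measure Ω) [IsProbabilityMeasure P]
    (rC rD : Ω → ℝ) (hmC : Measurable rC) (hmD : Measurable rD)
    (hC0 : ∀ ω, 0 ≤ rC ω) (hD0 : ∀ ω, 0 ≤ rD ω)
    (hCi : Integrable rC P) (hDi : Integrable rD P)
    (rth : ℝ) (hrth : 0 ≤ rth)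
    (lamStar aStar : ℝ) (hlam : 0 ≤ lamStar) (ha0 : 0 ≤ aStar) (ha1 : aStar ≤ 1)
    (heq : ∫ ω, (1 - thresholdPolicy rC rD lamStar aStar ω) * rC ω ∂P = rth) :
    ∀ π : Ω → ℝ, Measurable π → (∀ ω, 0 ≤ π ω) → (∀ ω, π ω ≤ 1) →
      rth ≤ (∫ ω, (1 - π ω) * rC ω ∂P) →
      (∫ ω, π ω * rD ω ∂P) ≤ ∫ ω, thresholdPolicy rC rD lamStar aStar ω * rD ω ∂P := by
  intro π hπm hπ0 hπ1 hfeas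
  have key : ∀ (p r : Ω → ℝ), Measurable p → (∀ ω, 0 ≤ p ω) → (∀ ω, p ω ≤ 1) →
      Integrable r P → Integrable (fun ω => p ω * r ω) P := by
    intro p r hp h0 h1 hr
    refine hr.bdd_mul (c := 1) hp.aestronglyMeasurable (Eventually.of_forall fun ω => ?_)
    rw [Real.norm_eq_abs, abs_of_nonneg (h0 ω)]
    exact h1 ω
  set T := thresholdPolicy rC rD lamStar aStar with hT
  have hTm : Measurable T := by
    rw [hT]
    unfold thresholdPolicy
    exact Measurable.ite (measurableSet_lt hmD (hmC.const_mul _)) measurable_const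
      (Measurable.ite (measurableSet_eq_fun (hmC.const_mul _) hmD) measurable_const
        measurable_const)
  have hT0 : ∀ ω, 0 ≤ T ω := by
    intro ω
    simp only [hT, thresholdPolicy]
    split_ifs <;> linarith
  have hT1 : ∀ ω, T ω ≤ 1 := by
    intro ω
    simp only [hT, thresholdPolicy]
    split_ifs <;> linarith
  have c : ∀ p : Ω → ℝ, Measurable p → (∀ ω, 0 ≤ p ω) → (∀ ω, p ω ≤ 1) →
      Integrable (fun ω => lamStar * ((1 - p ω) * rC ω)) P := by
    intro p hp h0 h1
    refine Integrable.const_mul (key (fun ω => 1 - p ω) rC (measurable_const.sub hp) ?_ ?_ hCi) _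
    · intro ω; linarith [h1 ω]
    · intro ω; linarith [h0 ω]
  have hle : ∫ ω, (π ω * rD ω + lamStar * ((1 - π ω) * rC ω)) ∂P
      ≤ ∫ ω, (T ω * rD ω + lamStar * ((1 - T ω) * rC ω)) ∂P := by
    refine integral_mono ((key π rD hπm hπ0 hπ1 hDi).add (c π hπm hπ0 hπ1))
      ((key T rD hTm hT0 hT1 hDi).add (c T hTm hT0 hT1)) fun ω => ?_
    have h0 := hπ0 ω
    have h1 := hπ1 ω
    suffices h : 0 ≤ (T ω - π ω) * (rD ω - lamStar * rC ω) by
      simp only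
      nlinarith [h]
    simp only [hT, thresholdPolicy]
    split_ifs with h2 h3
    · exact mul_nonneg_of_nonpos_of_nonpos (by linarith) (by linarith)
    · rw [h3]; simp
    · exact mul_nonneg (by linarith) (by linarith)
  rw [integral_add (key π rD hπm hπ0 hπ1 hDi) (c π hπm hπ0 hπ1),
    integral_add (key T rD hTm hT0 hT1 hDi) (c T hTm hT0 hT1),
    integral_const_mul, integral_const_mul, heq] at hle
  have := mul_le_mul_of_nonneg_left hfeas hlam
  linarith
end

section
/- If the set S = {λ ∈ [0, ∞) : F(λ) ≥ r_th} is nonempty, then S has a least element; i.e., the minimum λ* = min{λ ≥ 0 : E[r_C · 1{λ r_C ≥ r_D}] ≥ r_th} used to define the optimal threshold policy is attained. -/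
open MeasureTheory Filter

/-- if `S = {λ ∈ [0,∞) : F(λ) ≥ r_th}` is nonempty then it has a
least element, i.e. the minimum `λ*` defining the optimal threshold policy is attained. -/
theorem exists_least_threshold
    {Ω : Type*} [MeasurableSpace Ω] (P : Measure Ω) [IsProbabilityMeasure P]
    (rC rD : Ω → ℝ) (hmC : Measurable rC) (hmD : Measurable rD)
    (hC0 : ∀ ω, 0 ≤ rC ω) (hD0 : ∀ ω, 0 ≤ rD ω)
    (hCi : Integrable rC P) (hDi : Integrable rD P)
    (rth : ℝ) (hrth : 0 ≤ rth) :
    ({lam : ℝ | 0 ≤ lam ∧ rth ≤ Fthr P rC rD lam}).Nonempty →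
      ∃ lamStar : ℝ, IsLeast {lam : ℝ | 0 ≤ lam ∧ rth ≤ Fthr P rC rD lam} lamStar := by
  intro hne
  have hbdd : BddBelow {lam : ℝ | 0 ≤ lam ∧ rth ≤ Fthr P rC rD lam} := ⟨0, fun x hx => hx.1⟩
  obtain ⟨u, -, hut, hu⟩ := exists_seq_tendsto_sInf hne hbdd
  have hle : ∀ n, sInf {lam : ℝ | 0 ≤ lam ∧ rth ≤ Fthr P rC rD lam} ≤ u n :=
    fun n => csInf_le hbdd (hu n)
  have hlb : ∀ x ∈ {lam : ℝ | 0 ≤ lam ∧ rth ≤ Fthr P rC rD lam},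
      sInf {lam : ℝ | 0 ≤ lam ∧ rth ≤ Fthr P rC rD lam} ≤ x := fun x hx => csInf_le hbdd hx
  have h0 : 0 ≤ sInf {lam : ℝ | 0 ≤ lam ∧ rth ≤ Fthr P rC rD lam} :=
    le_csInf hne (fun x hx => hx.1)
  refine ⟨sInf {lam : ℝ | 0 ≤ lam ∧ rth ≤ Fthr P rC rD lam}, ⟨h0, ?_⟩, hlb⟩
  generalize sInf {lam : ℝ | 0 ≤ lam ∧ rth ≤ Fthr P rC rD lam} = s at *
  have hlim : Tendsto (fun n => Fthr P rC rD (u n)) atTop (nhds (Fthr P rC rD s)) := by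
    unfold Fthr
    refine tendsto_integral_of_dominated_convergence rC ?_ hCi ?_ ?_
    · intro n
      exact (Measurable.ite (measurableSet_le hmD (hmC.const_mul _)) hmC
        measurable_const).aestronglyMeasurable
    · intro n
      refine Eventually.of_forall fun ω => ?_
      have := hC0 ω
      split_ifs
      · rw [Real.norm_of_nonneg this]
      · simpa using this
    · refine Eventually.of_forall fun ω => ?_
      by_cases h : rD ω ≤ s * rC ω
      · have h' : ∀ n, rD ω ≤ u n * rC ω := fun n =>
          h.trans (mul_le_mul_of_nonneg_right (hle n) (hC0 ω))
        simp [h, h']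
      · have ht : Tendsto (fun n => u n * rC ω) atTop (nhds (s * rC ω)) := hut.mul_const _
        refine tendsto_const_nhds.congr' ?_
        filter_upwards [ht.eventually_lt_const (not_le.mp h)] with n hn
        rw [if_neg h, if_neg (not_le.mpr hn)]
  exact ge_of_tendsto' hlim fun n => (hu n).2
end

section
/- For every λ₀ > 0, the left limit of F at λ₀ equals E[r_C · 1{λ₀ r_C > r_D}]; that is, F(λ) → E[r_C · 1{λ₀ r_C > r_D}] as λ → λ₀ from the left. -/
open MeasureTheory Filter

/-- for `λ₀ > 0`, the left limit of `F` at `λ₀` equals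
`E[r_C · 1{λ₀ r_C > r_D}]`. -/
theorem Fthr_left_limit
    {Ω : Type*} [MeasurableSpace Ω] (P : Measure Ω) [IsProbabilityMeasure P]
    (rC rD : Ω → ℝ) (hmC : Measurable rC) (hmD : Measurable rD)
    (hC0 : ∀ ω, 0 ≤ rC ω) (hD0 : ∀ ω, 0 ≤ rD ω)
    (hCi : Integrable rC P) (hDi : Integrable rD P) :
    ∀ lam0 : ℝ, 0 < lam0 →
      Tendsto (fun lam => Fthr P rC rD lam) (nhdsWithin lam0 (Set.Iio lam0))
        (nhds (∫ ω, (if rD ω < lam0 * rC ω then rC ω else 0) ∂P)) := by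
  intro lam0 _
  unfold Fthr
  refine tendsto_integral_filter_of_dominated_convergence rC ?_ ?_ hCi ?_
  · refine Eventually.of_forall fun lam => ?_
    exact (Measurable.ite (measurableSet_le hmD (hmC.const_mul lam)) hmC
      measurable_const).aestronglyMeasurable
  · refine Eventually.of_forall fun lam => Eventually.of_forall fun ω => ?_
    split_ifs
    · rw [Real.norm_of_nonneg (hC0 ω)]
    · simpa using hC0 ω
  · refine Eventually.of_forall fun ω => ?_
    apply tendsto_const_nhds.congr'
    by_cases h : rD ω < lam0 * rC ω
    · have hc : Continuous fun lam : ℝ => lam * rC ω := by fun_prop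
      have h1 : ∀ᶠ lam in nhds lam0, rD ω < lam * rC ω :=
        hc.continuousAt.eventually (lt_mem_nhds h)
      filter_upwards [h1.filter_mono nhdsWithin_le_nhds] with lam hl
      rw [if_pos h, if_pos hl.le]
    · filter_upwards [self_mem_nhdsWithin] with lam hl
      rw [if_neg h]
      split_ifs with h2
      · have hl' : lam < lam0 := hl
        rcases (hC0 ω).eq_or_lt with h0 | h0
        · exact h0
        · exact absurd (lt_of_le_of_lt h2 (mul_lt_mul_of_pos_right hl' h0)) h
      · rfl
end

section
/- Suppose λ* is the least element of the set {λ ∈ [0, ∞) : F(λ) ≥ r_th}. Then E[r_C · 1{λ* r_C > r_D}] ≤ r_th ≤ F(λ*), and consequently there exists α* ∈ [0,1] such that E[(1 − π_{λ*,α*}) r_C] = r_th, i.e., the threshold policy π_{λ*,α*} satisfies the CU's rate constraint with equality. -/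
open MeasureTheory Filter

/-- if `λ*` is the least element of `{λ ≥ 0 : F(λ) ≥ r_th}`, then
`E[r_C · 1{λ* r_C > r_D}] ≤ r_th ≤ F(λ*)` and there exists `α* ∈ [0,1]` such that the
threshold policy `π_{λ*,α*}` satisfies the CU's rate constraint with equality. -/
theorem exists_alpha_constraint_equality
    {Ω : Type*} [MeasurableSpace Ω] (P : Measure Ω) [IsProbabilityMeasure P]
    (rC rD : Ω → ℝ) (hmC : Measurable rC) (hmD : Measurable rD)
    (hC0 : ∀ ω, 0 ≤ rC ω) (hD0 : ∀ ω, 0 ≤ rD ω)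
    (hCi : Integrable rC P) (hDi : Integrable rD P)
    (rth : ℝ) (hrth : 0 ≤ rth)
    (lamStar : ℝ)
    (hleast : IsLeast {lam : ℝ | 0 ≤ lam ∧ rth ≤ Fthr P rC rD lam} lamStar) :
    (∫ ω, (if rD ω < lamStar * rC ω then rC ω else 0) ∂P) ≤ rth ∧
    rth ≤ Fthr P rC rD lamStar ∧
    ∃ aStar : ℝ, 0 ≤ aStar ∧ aStar ≤ 1 ∧
      ∫ ω, (1 - thresholdPolicy rC rD lamStar aStar ω) * rC ω ∂P = rth := by
  obtain ⟨⟨hl0, hF⟩, hmin⟩ := hleast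
  have mle : ∀ l : ℝ, Measurable (fun ω => if rD ω ≤ l * rC ω then rC ω else 0) := fun l =>
    Measurable.ite (measurableSet_le hmD (hmC.const_mul l)) hmC measurable_const
  have mlt : ∀ l : ℝ, Measurable (fun ω => if rD ω < l * rC ω then rC ω else 0) := fun l =>
    Measurable.ite (measurableSet_lt hmD (hmC.const_mul l)) hmC measurable_const
  have ble : ∀ (l : ℝ) ω, ‖(if rD ω ≤ l * rC ω then rC ω else 0)‖ ≤ rC ω := by
    intro l ω
    have := hC0 ω
    split_ifs <;> simp [abs_of_nonneg, this]
  have blt : ∀ (l : ℝ) ω, ‖(if rD ω < l * rC ω then rC ω else 0)‖ ≤ rC ω := by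
    intro l ω
    have := hC0 ω
    split_ifs <;> simp [abs_of_nonneg, this]
  have ile : ∀ l : ℝ, Integrable (fun ω => if rD ω ≤ l * rC ω then rC ω else 0) P := fun l =>
    hCi.mono' (mle l).aestronglyMeasurable (Eventually.of_forall (ble l))
  have ilt : ∀ l : ℝ, Integrable (fun ω => if rD ω < l * rC ω then rC ω else 0) P := fun l =>
    hCi.mono' (mlt l).aestronglyMeasurable (Eventually.of_forall (blt l))
  have hG : (∫ ω, (if rD ω < lamStar * rC ω then rC ω else 0) ∂P) ≤ rth := by
    rcases hl0.eq_or_lt with h0 | hpos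
    · subst h0
      have : ∀ ω, (if rD ω < 0 * rC ω then rC ω else 0) = 0 := by
        intro ω
        have := hD0 ω
        rw [if_neg]; linarith
      simp only [this, integral_zero]
      exact hrth
    · have ht : Tendsto (fun l => Fthr P rC rD l) (nhdsWithin lamStar (Set.Iio lamStar))
          (nhds (∫ ω, (if rD ω < lamStar * rC ω then rC ω else 0) ∂P)) := by
        unfold Fthr
        refine tendsto_integral_filter_of_dominated_convergence rC
          (Eventually.of_forall fun l => (mle l).aestronglyMeasurable)
          (Eventually.of_forall fun l => Eventually.of_forall (ble l)) hCi
          (Eventually.of_forall fun ω => ?_)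
        apply tendsto_const_nhds.congr'
        by_cases h : rD ω < lamStar * rC ω
        · have hc : Tendsto (fun l : ℝ => l * rC ω) (nhdsWithin lamStar (Set.Iio lamStar))
              (nhds (lamStar * rC ω)) :=
            ((continuous_id.mul continuous_const).tendsto lamStar).mono_left nhdsWithin_le_nhds
          filter_upwards [hc.eventually (lt_mem_nhds h)] with l hl
          rw [if_pos h, if_pos hl.le]
        · filter_upwards [self_mem_nhdsWithin] with l hl
          rw [if_neg h]
          rcases (hC0 ω).eq_or_lt with h1 | h1
          · simp [← h1]
          · rw [if_neg]
            have : l * rC ω < lamStar * rC ω := mul_lt_mul_of_pos_right hl h1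
            linarith
      refine le_of_tendsto ht ?_
      filter_upwards [Ioo_mem_nhdsLT hpos] with l hl
      by_contra hlt
      exact absurd (hmin ⟨hl.1.le, (not_le.mp hlt).le⟩) (not_le.mpr hl.2)
  refine ⟨hG, hF, ?_⟩
  have key : ∀ a : ℝ, ∫ ω, (1 - thresholdPolicy rC rD lamStar a ω) * rC ω ∂P =
      a * (∫ ω, (if rD ω < lamStar * rC ω then rC ω else 0) ∂P)
        + (1 - a) * Fthr P rC rD lamStar := by
    intro a
    unfold Fthr
    rw [← integral_const_mul, ← integral_const_mul,
      ← integral_add ((ilt _).const_mul _) ((ile _).const_mul _)]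
    congr 1
    funext ω
    unfold thresholdPolicy
    rcases lt_trichotomy (rD ω) (lamStar * rC ω) with h | h | h
    · simp only [if_pos h, if_pos h.le]; ring
    · simp only [h, lt_irrefl, le_refl, if_true, if_false]; ring
    · simp only [if_neg h.not_gt, if_neg h.not_ge, if_neg h.ne]; ring
  simp only [key]
  generalize (∫ ω, (if rD ω < lamStar * rC ω then rC ω else 0) ∂P) = G at *
  generalize Fthr P rC rD lamStar = F at *
  rcases (hG.trans hF).eq_or_lt with h | h
  · exact ⟨1, by norm_num, le_rfl, by linarith⟩
  · have hd : 0 < F - G := by linarith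
    refine ⟨(F - rth) / (F - G), div_nonneg (by linarith) hd.le,
      (div_le_one hd).2 (by linarith), ?_⟩
    field_simp
    ring
end

section
/- Suppose λ* ≥ 0 and α* ∈ [0,1] satisfy E[(1 − π_{λ*,α*}) r_C] = r_th. Then for every λ with 0 ≤ λ ≤ λ*, g(λ) ≥ g(λ*); i.e., the dual function g does not increase when moving from any point left of λ* to λ*. -/
open MeasureTheory Filter

/-- if `π_{λ*,α*}` satisfies the CU's rate constraint with equality,
then `g` does not increase when moving from any `λ ∈ [0, λ*]` to `λ*`. -/
theorem dual_nonincreasing_left_of_lamStar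
    {Ω : Type*} [MeasurableSpace Ω] (P : Measure Ω) [IsProbabilityMeasure P]
    (rC rD : Ω → ℝ) (hmC : Measurable rC) (hmD : Measurable rD)
    (hC0 : ∀ ω, 0 ≤ rC ω) (hD0 : ∀ ω, 0 ≤ rD ω)
    (hCi : Integrable rC P) (hDi : Integrable rD P)
    (rth : ℝ) (hrth : 0 ≤ rth)
    (lamStar aStar : ℝ) (hlam : 0 ≤ lamStar) (ha0 : 0 ≤ aStar) (ha1 : aStar ≤ 1)
    (heq : ∫ ω, (1 - thresholdPolicy rC rD lamStar aStar ω) * rC ω ∂P = rth) :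
    ∀ lam : ℝ, 0 ≤ lam → lam ≤ lamStar →
      dualFn P rC rD rth lamStar ≤ dualFn P rC rD rth lam := by
  intro lam _ hle
  have hmp : Measurable (thresholdPolicy rC rD lamStar aStar) := by
    unfold thresholdPolicy
    exact Measurable.ite (measurableSet_lt hmD (hmC.const_mul _)) measurable_const
      (Measurable.ite (measurableSet_eq_fun (hmC.const_mul _) hmD) measurable_const
        measurable_const)
  have hp : ∀ ω, 0 ≤ thresholdPolicy rC rD lamStar aStar ω ∧
      thresholdPolicy rC rD lamStar aStar ω ≤ 1 ∧
      max (rD ω - lamStar * rC ω) 0 =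
        thresholdPolicy rC rD lamStar aStar ω * (rD ω - lamStar * rC ω) := by
    intro ω
    unfold thresholdPolicy
    split_ifs with h1 h2
    · refine ⟨le_rfl, zero_le_one, ?_⟩
      rw [max_eq_right (by linarith)]; ring
    · refine ⟨ha0, ha1, ?_⟩
      rw [h2]; simp
    · refine ⟨zero_le_one, le_rfl, ?_⟩
      rw [max_eq_left (by linarith)]; ring
  have hI : Integrable (fun ω => (1 - thresholdPolicy rC rD lamStar aStar ω) * rC ω) P := by
    refine hCi.mono ((measurable_const.sub hmp).mul hmC).aestronglyMeasurable
      (Eventually.of_forall fun ω => ?_)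
    obtain ⟨h0, h1, _⟩ := hp ω
    rw [norm_mul]
    refine mul_le_of_le_one_left (norm_nonneg _) ?_
    rw [Real.norm_eq_abs, abs_le]
    constructor <;> linarith
  have hM : ∀ l : ℝ, Integrable (fun ω => max (rD ω - l * rC ω) 0) P := fun l =>
    (hDi.sub (hCi.const_mul l)).pos_part
  have hS : Integrable (fun ω => (lamStar - lam) *
      (rC ω - (1 - thresholdPolicy rC rD lamStar aStar ω) * rC ω)) P :=
    (hCi.sub hI).const_mul _
  have key : ∫ ω, (max (rD ω - lamStar * rC ω) 0 + (lamStar - lam) *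
      (rC ω - (1 - thresholdPolicy rC rD lamStar aStar ω) * rC ω)) ∂P
      ≤ ∫ ω, max (rD ω - lam * rC ω) 0 ∂P := by
    refine integral_mono ((hM lamStar).add hS) (hM lam) fun ω => ?_
    obtain ⟨h0, h1, h2⟩ := hp ω
    simp only
    rw [h2]
    have h3 := mul_le_mul_of_nonneg_left (le_max_left (rD ω - lam * rC ω) 0) h0
    have h4 := mul_le_mul_of_nonneg_right h1 (le_max_right (rD ω - lam * rC ω) 0)
    linarith
  rw [integral_add (hM lamStar) hS, integral_const_mul, integral_sub hCi hI, heq] at key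
  unfold dualFn
  linarith
end

section
/- Suppose λ* ≥ 0 and α* ∈ [0,1] satisfy E[(1 − π_{λ*,α*}) r_C] = r_th. Then λ* is a global minimizer of the dual function: g(λ*) ≤ g(λ) for all λ ≥ 0. -/
open MeasureTheory Filter

/-- if `π_{λ*,α*}` satisfies the CU's rate constraint with equality,
then `λ*` is a global minimizer of the dual function. -/
theorem lamStar_minimizes_dual
    {Ω : Type*} [MeasurableSpace Ω] (P : Measure Ω) [IsProbabilityMeasure P]
    (rC rD : Ω → ℝ) (hmC : Measurable rC) (hmD : Measurable rD)
    (hC0 : ∀ ω, 0 ≤ rC ω) (hD0 : ∀ ω, 0 ≤ rD ω)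
    (hCi : Integrable rC P) (hDi : Integrable rD P)
    (rth : ℝ) (hrth : 0 ≤ rth)
    (lamStar aStar : ℝ) (hlam : 0 ≤ lamStar) (ha0 : 0 ≤ aStar) (ha1 : aStar ≤ 1)
    (heq : ∫ ω, (1 - thresholdPolicy rC rD lamStar aStar ω) * rC ω ∂P = rth) :
    ∀ lam : ℝ, 0 ≤ lam → dualFn P rC rD rth lamStar ≤ dualFn P rC rD rth lam := by
  intro lam _
  have hpm : Measurable (thresholdPolicy rC rD lamStar aStar) := by
    unfold thresholdPolicy
    refine Measurable.ite (measurableSet_lt hmD (hmC.const_mul _)) measurable_const ?_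
    exact Measurable.ite (measurableSet_eq_fun (hmC.const_mul _) hmD)
      measurable_const measurable_const
  have hp : ∀ ω, 0 ≤ thresholdPolicy rC rD lamStar aStar ω ∧
      thresholdPolicy rC rD lamStar aStar ω ≤ 1 := by
    intro ω
    unfold thresholdPolicy
    split_ifs <;> constructor <;> linarith
  have hqi : Integrable (fun ω => (1 - thresholdPolicy rC rD lamStar aStar ω) * rC ω) P := by
    refine hCi.mono ((measurable_const.sub hpm).mul hmC).aestronglyMeasurable ?_
    refine Filter.Eventually.of_forall fun ω => ?_
    have h := hp ω
    rw [Real.norm_eq_abs, Real.norm_eq_abs, abs_mul, abs_of_nonneg (by linarith : (0:ℝ) ≤ 1 - thresholdPolicy rC rD lamStar aStar ω)]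
    nlinarith [abs_nonneg (rC ω)]
  have hmi : ∀ l : ℝ, Integrable (fun ω => max (rD ω - l * rC ω) 0) P := fun l =>
    (hDi.sub (hCi.const_mul l)).pos_part
  have key : ∀ ω, max (rD ω - lamStar * rC ω) 0 + ((lamStar - lam) * rC ω
      - (lamStar - lam) * ((1 - thresholdPolicy rC rD lamStar aStar ω) * rC ω))
      ≤ max (rD ω - lam * rC ω) 0 := by
    intro ω
    have h1 := le_max_left (rD ω - lam * rC ω) 0
    have h2 := le_max_right (rD ω - lam * rC ω) 0
    have h := hp ω
    have h3 : max (rD ω - lamStar * rC ω) 0 =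
        thresholdPolicy rC rD lamStar aStar ω * (rD ω - lamStar * rC ω) := by
      unfold thresholdPolicy
      split_ifs with ha hb
      · rw [max_eq_right (by linarith)]; ring
      · rw [hb]; simp
      · rw [max_eq_left (by linarith)]; ring
    rw [h3]
    nlinarith [mul_le_mul_of_nonneg_left h1 h.1, mul_nonneg (sub_nonneg.2 h.2) h2]
  have hint := integral_mono ((hmi lamStar).add ((hCi.const_mul (lamStar - lam)).sub
    (hqi.const_mul (lamStar - lam)))) (hmi lam) key
  rw [integral_add' (hmi lamStar) ((hCi.const_mul (lamStar - lam)).sub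
    (hqi.const_mul (lamStar - lam))), integral_sub' (hCi.const_mul (lamStar - lam))
    (hqi.const_mul (lamStar - lam)), integral_const_mul, integral_const_mul, heq] at hint
  unfold dualFn
  linarith
end

section
/- Suppose λ* ≥ 0 and α* ∈ [0,1] satisfy E[(1 − π_{λ*,α*}) r_C] = r_th. Then there is no duality gap at λ*: E[π_{λ*,α*} r_D] = g(λ*). -/
open MeasureTheory Filter

/-- if `π_{λ*,α*}` satisfies the CU's rate constraint with equality,
then there is no duality gap at `λ*`: `E[π_{λ*,α*} r_D] = g(λ*)`. -/
theorem no_duality_gap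
    {Ω : Type*} [MeasurableSpace Ω] (P : Measure Ω) [IsProbabilityMeasure P]
    (rC rD : Ω → ℝ) (hmC : Measurable rC) (hmD : Measurable rD)
    (hC0 : ∀ ω, 0 ≤ rC ω) (hD0 : ∀ ω, 0 ≤ rD ω)
    (hCi : Integrable rC P) (hDi : Integrable rD P)
    (rth : ℝ) (hrth : 0 ≤ rth)
    (lamStar aStar : ℝ) (hlam : 0 ≤ lamStar) (ha0 : 0 ≤ aStar) (ha1 : aStar ≤ 1)
    (heq : ∫ ω, (1 - thresholdPolicy rC rD lamStar aStar ω) * rC ω ∂P = rth) :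
    (∫ ω, thresholdPolicy rC rD lamStar aStar ω * rD ω ∂P) =
      dualFn P rC rD rth lamStar := by
  have hm : Measurable (thresholdPolicy rC rD lamStar aStar) := by
    unfold thresholdPolicy
    exact Measurable.ite (measurableSet_lt hmD (hmC.const_mul _)) measurable_const
      (Measurable.ite (measurableSet_eq_fun (hmC.const_mul _) hmD)
        measurable_const measurable_const)
  have hi : Integrable (fun ω => (1 - thresholdPolicy rC rD lamStar aStar ω) * rC ω) P := by
    refine hCi.bdd_mul (c := 1) (measurable_const.sub hm).aestronglyMeasurable ?_
    refine Eventually.of_forall fun ω => ?_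
    rw [Real.norm_eq_abs, abs_le]
    unfold thresholdPolicy
    split_ifs <;> constructor <;> linarith
  have hmax : Integrable (fun ω => max (rD ω - lamStar * rC ω) 0) P :=
    (hDi.sub (hCi.const_mul lamStar)).pos_part
  have key : ∀ ω, thresholdPolicy rC rD lamStar aStar ω * rD ω =
      max (rD ω - lamStar * rC ω) 0 +
        lamStar * (rC ω - (1 - thresholdPolicy rC rD lamStar aStar ω) * rC ω) := by
    intro ω
    unfold thresholdPolicy
    split_ifs with h1 h2
    · rw [max_eq_right (by linarith)]; ring
    · rw [← h2, max_eq_right (by linarith)]; ring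
    · rw [max_eq_left (by linarith)]; ring
  have hs : Integrable (fun ω => lamStar *
      (rC ω - (1 - thresholdPolicy rC rD lamStar aStar ω) * rC ω)) P :=
    (hCi.sub hi).const_mul lamStar
  unfold dualFn
  rw [integral_congr_ae (Eventually.of_forall key),
    integral_add hmax hs, integral_const_mul,
    integral_sub hCi hi, heq]
end

section
/- For every finite set M of CUs, every finite set N of D2D pairs, every payoff matrix v : M × N → ℝ, and every ε > 0, there exists an ε-stable matching (μ, p). -/
def AucInv {M N : Type*} (v : M → N → ℝ) (ε : ℝ) (f : N → Option M) (k : M → ℕ) : Prop :=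
  (∀ n n' m, f n = some m → f n' = some m → n = n') ∧
  (∀ m, k m ≠ 0 → ∃ n, f n = some m) ∧
  (∀ n m, f n = some m → 0 ≤ v m n - ε * k m ∧
    ∀ m', v m' n - ε * k m' - ε ≤ v m n - ε * k m)

theorem auc_step {M N : Type*} [Fintype M] (v : M → N → ℝ) (ε : ℝ) (hε : 0 < ε)
    (f : N → Option M) (k : M → ℕ) (h : AucInv v ε f k) (n : N) (hn : f n = none)
    (m₀ : M) (hm₀ : ε < v m₀ n - ε * k m₀) :
    ∃ f' k', AucInv v ε f' k' ∧ ∑ m, k' m = ∑ m, k m + 1 := by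
  classical
  obtain ⟨h1, h2, h3⟩ := h
  obtain ⟨m, -, hm⟩ := Finset.exists_max_image Finset.univ (fun m => v m n - ε * k m)
    ⟨m₀, Finset.mem_univ _⟩
  have hmm : ε < v m n - ε * k m := lt_of_lt_of_le hm₀ (hm m₀ (Finset.mem_univ _))
  let f' : N → Option M := fun x => if x = n then some m else if f x = some m then none else f x
  let k' : M → ℕ := fun x => k x + if x = m then 1 else 0
  have hk : ∀ x, ε * (k x : ℝ) ≤ ε * (k' x : ℝ) := by
    intro x
    apply mul_le_mul_of_nonneg_left _ hε.le
    exact_mod_cast Nat.le_add_right _ _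
  have hkm : ε * (k' m : ℝ) = ε * k m + ε := by simp [k']; ring
  have hkx : ∀ x, x ≠ m → k' x = k x := by intro x hx; simp [k', hx]
  have hf : ∀ x y, f' x = some y → (x = n ∧ y = m) ∨ (x ≠ n ∧ y ≠ m ∧ f x = some y) := by
    intro x y hxy
    simp only [f'] at hxy
    split_ifs at hxy with a b
    · left; exact ⟨a, by simpa using hxy.symm⟩
    · right; exact ⟨a, by rintro rfl; exact b hxy, hxy⟩
  refine ⟨f', k', ⟨?_, ?_, ?_⟩, ?_⟩
  · intro x x' y hx hx'
    rcases hf _ _ hx with a | a <;> rcases hf _ _ hx' with b | b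
    · rw [a.1, b.1]
    · exact absurd a.2 b.2.1
    · exact absurd b.2 a.2.1
    · exact h1 _ _ _ a.2.2 b.2.2
  · intro y hy
    by_cases hym : y = m
    · exact ⟨n, by simp [f', hym]⟩
    · rw [hkx y hym] at hy
      obtain ⟨x, hx⟩ := h2 y hy
      refine ⟨x, ?_⟩
      have : x ≠ n := by rintro rfl; simp [hn] at hx
      simp [f', this, hx, hym]
  · intro x y hxy
    rcases hf _ _ hxy with ⟨rfl, rfl⟩ | ⟨a, b, c⟩
    · rw [hkm]
      refine ⟨by linarith, fun z => ?_⟩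
      have := hm z (Finset.mem_univ _)
      have := hk z
      linarith
    · rw [hkx y b]
      refine ⟨(h3 x y c).1, fun z => ?_⟩
      have := (h3 x y c).2 z
      have := hk z
      linarith
  · simp [k', Finset.sum_add_distrib]

theorem auc_terminal {M N : Type*} [Fintype M] [Fintype N] (v : M → N → ℝ) (ε : ℝ)
    (hε : 0 < ε) : ∃ f k, AucInv v ε f k ∧ ∀ n, f n = none → ∀ m, v m n - ε * k m ≤ ε := by
  by_contra! hcon
  have key : ∀ j : ℕ, ∃ f k, AucInv v ε f k ∧ ∑ m, k m = j := by
    intro j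
    induction j with
    | zero => exact ⟨fun _ => none, fun _ => 0, ⟨by simp, by simp, by simp⟩, by simp⟩
    | succ j ih =>
      obtain ⟨f, k, h, hs⟩ := ih
      obtain ⟨n, hn, m, hm⟩ := hcon f k h
      obtain ⟨f', k', h', hs'⟩ := auc_step v ε hε f k h n hn m hm
      exact ⟨f', k', h', by omega⟩
  obtain ⟨B, hB⟩ := exists_nat_gt ((∑ m, ∑ n, |v m n|) / ε)
  rw [div_lt_iff₀ hε] at hB
  obtain ⟨f, k, ⟨h1, h2, h3⟩, hs⟩ := key (Fintype.card M * B + 1)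
  have hb : ∀ m, k m ≤ B := by
    intro m
    by_contra! hlt
    obtain ⟨n, hn⟩ := h2 m (by omega)
    have e1 := (h3 n m hn).1
    have e2 : |v m n| ≤ ∑ n, |v m n| :=
      Finset.single_le_sum (f := fun n => |v m n|) (fun _ _ => abs_nonneg _) (Finset.mem_univ n)
    have e3 : ∑ n, |v m n| ≤ ∑ m, ∑ n, |v m n| :=
      Finset.single_le_sum (f := fun m => ∑ n, |v m n|)
        (fun _ _ => Finset.sum_nonneg fun _ _ => abs_nonneg _) (Finset.mem_univ m)
    have e4 := le_abs_self (v m n)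
    have e5 : (B : ℝ) < k m := by exact_mod_cast hlt
    nlinarith
  have := Finset.sum_le_card_nsmul Finset.univ k B (fun m _ => hb m)
  rw [hs, Finset.card_univ, smul_eq_mul] at this
  omega

/-- for every finite set of CUs `M`, finite set of D2D pairs `N`,
payoff matrix `v : M × N → ℝ` and `ε > 0`, there exists an `ε`-stable matching
`(μ, p)`.  A one-to-one mapping is encoded by `muM : M → Option N` and
`muN : N → Option M` with `muM m = some n ↔ muN n = some m` (`none` = unmatched);
`p` is the price vector of the CUs.  The utility of CU `m` is `θ_m = p m` and the
utility of D2D pair `n` is `δ_n = v (μ n) n − p (μ n)` when matched, `0` otherwise. -/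
theorem exists_epsilon_stable_matching
    (M N : Type*) [Fintype M] [Fintype N] (v : M → N → ℝ)
    (ε : ℝ) (hε : 0 < ε) :
    ∃ (muM : M → Option N) (muN : N → Option M) (p : M → ℝ),
      -- `(muM, muN)` is a one-to-one mapping: `μ(m) = n ↔ μ(n) = m`
      (∀ m n, muM m = some n ↔ muN n = some m) ∧
      -- prices are nonnegative (hence `θ_m = p m ≥ 0` for all CUs)
      (∀ m, 0 ≤ p m) ∧
      -- unmatched CUs have zero price
      (∀ m, muM m = none → p m = 0) ∧
      -- individual rationality of the D2D pairs: `δ_n ≥ 0`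
      (∀ n, 0 ≤ (muN n).elim 0 (fun m => v m n - p m)) ∧
      -- ε-stability: `θ_m + δ_n ≥ v(m,n) − ε` for every CU-D2D pair `(m, n)`
      (∀ m n, v m n - ε ≤ p m + (muN n).elim 0 (fun m' => v m' n - p m')) := by
  classical
  obtain ⟨f, k, ⟨h1, h2, h3⟩, ht⟩ := auc_terminal v ε hε
  refine ⟨fun m => if h : ∃ n, f n = some m then some h.choose else none, f,
    fun m => ε * k m, ?_, ?_, ?_, ?_, ?_⟩
  · intro m n
    beta_reduce
    constructor
    · intro h
      split_ifs at h with hx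
      have := hx.choose_spec
      rwa [Option.some.inj h] at this
    · intro h
      have hx : ∃ n, f n = some m := ⟨n, h⟩
      rw [dif_pos hx, h1 _ _ _ hx.choose_spec h]
  · intro m; positivity
  · intro m h
    by_cases hk : k m = 0
    · simp [hk]
    · simp [h2 m hk] at h
  · intro n
    cases h : f n with
    | none => simp
    | some m => simpa using (h3 n m h).1
  · intro m n
    cases h : f n with
    | none => have := ht n h m; simp only [Option.elim]; linarith
    | some m' => have := (h3 n m' h).2 m; simp only [Option.elim]; linarith
end
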